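/- arXiv:math/0612174 — 2 statements merged into one kernel-verified Lean document; each statement's English description precedes it below -/
import Mathlib

section
/- Let L be a Lie algebra over a field F of characteristic zero, let L̃ = F[t,t⁻¹] ⊗_F L be its loop algebra, and let h ∈ L. Define elements Λ_m ∈ U(L̃) by Λ_0 = 1 and, recursively for m ≥ 1, m·Λ_m = −∑_{s=1}^{m} ι(t^s ⊗ h)·Λ_{m−s}. Then for every a ∈ F with a ≠ 0 and every m ≥ 0, ev_a(Λ_m) = (−a)^m · ι(h)(ι(h)−1)⋯(ι(h)−m+1)/m! in U(L), where ev_a : U(L̃) → U(L) is the evaluation homomorphism determined by ι(t^r ⊗ x) ↦ a^r ι(x). -/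
open scoped TensorProduct
open LaurentPolynomial

variable (F : Type*) [Field F] [CharZero F] (L : Type*) [LieRing L] [LieAlgebra F L]

/-- The loop algebra `F[t,t⁻¹] ⊗[F] L` is a Lie algebra over `F`
(by restriction of scalars from `F[t,t⁻¹]`). -/
noncomputable instance loopLieAlgebra : LieAlgebra F (F[T;T⁻¹] ⊗[F] L) where
  lie_smul t x y := by
    rw [← algebraMap_smul F[T;T⁻¹] t y,
      lie_smul (algebraMap F F[T;T⁻¹] t) x y, algebraMap_smul]

/-- A sequence whose logarithmic derivative has coefficients `-a ^ s • x` satisfies the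
first-order recursion of the coefficients of `(1 - a u) ^ x`. -/
theorem succ_smul_of_newton_recursion {K A : Type*} [Field K] [Ring A] [Algebra K A]
    (a : K) (x : A) (y : ℕ → A)
    (hy : ∀ m : ℕ, 1 ≤ m → (m : K) • y m = -∑ s ∈ Finset.Icc 1 m, (a ^ s • x) * y (m - s))
    (m : ℕ) : ((m + 1 : ℕ) : K) • y (m + 1) = -a • ((x - (m : A)) * y m) := by
  have hsum (n : ℕ) : ∑ s ∈ Finset.Icc 1 n, (a ^ s • x) * y (n - s) =
      ∑ i ∈ Finset.range n, (a ^ (i + 1) • x) * y (n - (i + 1)) := by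
    rw [Finset.range_eq_Ico, Finset.sum_Ico_add' (fun s => (a ^ s • x) * y (n - s)) 0 n 1]
    rfl
  have hm : (m : K) • y m =
      -∑ i ∈ Finset.range m, (a ^ (i + 1) • x) * y (m - (i + 1)) := by
    rcases Nat.eq_zero_or_pos m with rfl | hpos
    · simp
    · rw [hy m hpos, hsum]
  have hshift : ∑ i ∈ Finset.range m, (a ^ (i + 1 + 1) • x) * y (m + 1 - (i + 1 + 1)) =
      a • ∑ i ∈ Finset.range m, (a ^ (i + 1) • x) * y (m - (i + 1)) := by
    rw [Finset.smul_sum]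
    refine Finset.sum_congr rfl fun i _ => ?_
    rw [Nat.add_sub_add_right, ← smul_mul_assoc, smul_smul, ← pow_succ']
  rw [hy (m + 1) (Nat.le_add_left 1 m), hsum, Finset.sum_range_succ', hshift,
    ← neg_eq_iff_eq_neg.mpr hm, sub_mul, ← nsmul_eq_mul m (y m), ← Nat.cast_smul_eq_nsmul K m (y m)]
  simp only [zero_add, pow_one, Nat.add_sub_cancel, smul_mul_assoc]
  module

/-- The coefficients of `(1 - a u) ^ x` are determined by the Newton-type recursion. -/
theorem eq_smul_prod_of_newton_recursion {K A : Type*} [Field K] [CharZero K] [Ring A]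
    [Algebra K A] (a : K) (x : A) (y : ℕ → A) (hy0 : y 0 = 1)
    (hy : ∀ m : ℕ, 1 ≤ m → (m : K) • y m = -∑ s ∈ Finset.Icc 1 m, (a ^ s • x) * y (m - s))
    (m : ℕ) :
    y m = (-a) ^ m • ((m.factorial : K)⁻¹ •
      ((List.range m).map fun j : ℕ => x - (j : A)).prod) := by
  induction m with
  | zero => simp [hy0]
  | succ m ih =>
    have hne : ((m + 1 : ℕ) : K) ≠ 0 := Nat.cast_ne_zero.mpr m.succ_ne_zero
    have hcomm : Commute (x - (m : A)) ((List.range m).map fun j : ℕ => x - (j : A)).prod := by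
      refine Commute.list_prod_right _ _ fun z hz => ?_
      obtain ⟨j, -, rfl⟩ := List.mem_map.mp hz
      exact ((Commute.refl x).sub_right (Nat.commute_cast x j)).sub_left (Nat.cast_commute m _)
    rw [← inv_smul_smul₀ hne (y (m + 1)), succ_smul_of_newton_recursion a x y hy, ih,
      List.prod_range_succ, ← hcomm.eq, Nat.factorial_succ, Nat.cast_mul, mul_inv]
    simp only [mul_smul_comm, smul_smul]
    congr 1
    ring

/-- If `Λ_m ∈ U(L̃)` are defined by `Λ_0 = 1` and
`m·Λ_m = −∑_{s=1}^m ι(tˢ ⊗ h)·Λ_{m−s}` for `m ≥ 1`, and `ev_a : U(L̃) → U(L)` is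
the evaluation homomorphism determined by `ι(tʳ ⊗ x) ↦ aʳ ι(x)` (`a ≠ 0`), then
`ev_a(Λ_m) = (−a)^m · ι(h)(ι(h)−1)⋯(ι(h)−m+1)/m!`. -/
theorem evaluation_of_Lambda (h : L)
    (Λ : ℕ → UniversalEnvelopingAlgebra F (F[T;T⁻¹] ⊗[F] L))
    (hΛ0 : Λ 0 = 1)
    (hΛ : ∀ m : ℕ, 1 ≤ m → (m : F) • Λ m =
      -∑ s ∈ Finset.Icc 1 m,
        UniversalEnvelopingAlgebra.ι F ((T (s : ℤ) : F[T;T⁻¹]) ⊗ₜ[F] h) * Λ (m - s))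
    (a : F) (ha : a ≠ 0)
    (ev : UniversalEnvelopingAlgebra F (F[T;T⁻¹] ⊗[F] L) →ₐ[F]
      UniversalEnvelopingAlgebra F L)
    (hev : ∀ (r : ℤ) (x : L),
      ev (UniversalEnvelopingAlgebra.ι F ((T r : F[T;T⁻¹]) ⊗ₜ[F] x)) =
        a ^ r • UniversalEnvelopingAlgebra.ι F x)
    (m : ℕ) :
    ev (Λ m) = (-a) ^ m • ((m.factorial : F)⁻¹ •
      ((List.range m).map fun j : ℕ =>
        UniversalEnvelopingAlgebra.ι F h - (j : UniversalEnvelopingAlgebra F L)).prod) := by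
  refine eq_smul_prod_of_newton_recursion a _ (fun n => ev (Λ n)) (by simp [hΛ0])
    (fun n hn => ?_) m
  rw [← map_smul, hΛ n hn, map_neg, map_sum]
  simp only [map_mul, hev, zpow_natCast]
end

section
/- Let g = sl₂(ℚ) with standard basis e, f, h satisfying [h,e] = 2e, [h,f] = −2f, [e,f] = h, let g̃ = ℚ[t,t⁻¹] ⊗ g be its loop algebra, and write x_r = ι(t^r ⊗ x) ∈ U(g̃) for x ∈ {e,h,f}, r ∈ ℤ. Define Λ_m ∈ U(g̃) by Λ_0 = 1 and m·Λ_m = −∑_{s=1}^{m} h_s·Λ_{m−s} for m ≥ 1. Let k ≥ l ≥ 1 be integers and s ∈ ℤ. For k−l ≤ j ≤ k set c_j = (1/(k−l)!)·∑ f_{s+r_1}⋯f_{s+r_{k−l}}, the sum over all (r_1,…,r_{k−l}) of positive integers with r_1+⋯+r_{k−l} = j (with c_0 = 1 when k = l), and set G = ∑_{j=k−l}^{k} c_j·Λ_{k−j}. Then (1/(l!·k!))·(e_{−s})^l·(f_{s+1})^k − (−1)^l·G lies in the left ideal of U(g̃) generated by the elements e_r, r ∈ ℤ. -/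
set_option synthInstance.maxHeartbeats 1000000
set_option maxHeartbeats 1000000

open scoped TensorProduct
open LaurentPolynomial LieAlgebra.SpecialLinear

/-- `e` in the standard basis of `sl₂(ℚ)`. -/
noncomputable def Esl2 : sl (Fin 2) ℚ :=
  ⟨!![0,1;0,0], show _ ∈ LinearMap.ker (Matrix.traceLinearMap (Fin 2) ℚ ℚ) by
    simp [LinearMap.mem_ker, Matrix.trace_fin_two]⟩

/-- `f` in the standard basis of `sl₂(ℚ)`. -/
noncomputable def Fsl2 : sl (Fin 2) ℚ :=
  ⟨!![0,0;1,0], show _ ∈ LinearMap.ker (Matrix.traceLinearMap (Fin 2) ℚ ℚ) by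
    simp [LinearMap.mem_ker, Matrix.trace_fin_two]⟩

/-- `h` in the standard basis of `sl₂(ℚ)`. -/
noncomputable def Hsl2 : sl (Fin 2) ℚ :=
  ⟨!![1,0;0,-1], show _ ∈ LinearMap.ker (Matrix.traceLinearMap (Fin 2) ℚ ℚ) by
    simp [LinearMap.mem_ker, Matrix.trace_fin_two]⟩

/-- The loop algebra `g̃ = ℚ[t,t⁻¹] ⊗ sl₂(ℚ)`. -/
abbrev loopSl2 := ℚ[T;T⁻¹] ⊗[ℚ] (sl (Fin 2) ℚ)

/-- The loop algebra is a Lie algebra over `ℚ`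
(by restriction of scalars from `ℚ[t,t⁻¹]`). -/
noncomputable instance : LieAlgebra ℚ loopSl2 where
  lie_smul t x y := by
    rw [← algebraMap_smul ℚ[T;T⁻¹] t y,
      lie_smul (algebraMap ℚ ℚ[T;T⁻¹] t) x y, algebraMap_smul]

/-- The universal enveloping algebra `U(g̃)`. -/
abbrev Ug : Type := UniversalEnvelopingAlgebra ℚ loopSl2

/-- `e_r = ι(tʳ ⊗ e) ∈ U(g̃)`. -/
noncomputable def Eel (r : ℤ) : Ug :=
  UniversalEnvelopingAlgebra.ι ℚ ((T r : ℚ[T;T⁻¹]) ⊗ₜ[ℚ] Esl2)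

/-- `f_r = ι(tʳ ⊗ f) ∈ U(g̃)`. -/
noncomputable def Fel (r : ℤ) : Ug :=
  UniversalEnvelopingAlgebra.ι ℚ ((T r : ℚ[T;T⁻¹]) ⊗ₜ[ℚ] Fsl2)

/-- `h_r = ι(tʳ ⊗ h) ∈ U(g̃)`. -/
noncomputable def Hel (r : ℤ) : Ug :=
  UniversalEnvelopingAlgebra.ι ℚ ((T r : ℚ[T;T⁻¹]) ⊗ₜ[ℚ] Hsl2)

section PowerSeries

open PowerSeries Finset

variable {A : Type*} [Ring A]

/-- The Euler operator `u d/du` on power series over a not necessarily commutative ring. -/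
noncomputable def PowerSeries.euler (a : A⟦X⟧) : A⟦X⟧ := mk fun n => n • coeff n a

lemma PowerSeries.coeff_euler (a : A⟦X⟧) (n : ℕ) : coeff n a.euler = n • coeff n a := by
  simp [euler]

lemma PowerSeries.euler_one : (1 : A⟦X⟧).euler = 0 := by
  ext n
  rcases n with _ | n <;> simp [coeff_euler, coeff_one]

lemma PowerSeries.euler_mul (a b : A⟦X⟧) : (a * b).euler = a.euler * b + a * b.euler := by
  ext n
  simp only [coeff_euler, map_add, coeff_mul, smul_sum, ← sum_add_distrib]
  refine sum_congr rfl fun p hp => ?_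
  rw [← HasAntidiagonal.mem_antidiagonal.mp hp, smul_mul_assoc, mul_smul_comm, add_smul]

/-- `u d/du (aⁿ) - n aⁿ`, which measures the failure of `aⁿ` to be homogeneous of degree `n`. -/
noncomputable def PowerSeries.eulerDefect (a : A⟦X⟧) (n : ℕ) : A⟦X⟧ := (a ^ n).euler - n • a ^ n

lemma PowerSeries.eulerDefect_zero (a : A⟦X⟧) : a.eulerDefect 0 = 0 := by
  simp [eulerDefect, euler_one]

lemma PowerSeries.eulerDefect_succ (a : A⟦X⟧) (n : ℕ) :
    a.eulerDefect (n + 1) = a.eulerDefect n * a + a ^ n * a.eulerDefect 1 := by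
  simp only [eulerDefect, pow_succ, euler_mul, pow_zero, one_mul,
    sub_mul, mul_sub, smul_mul_assoc, one_smul, add_smul]
  abel

lemma PowerSeries.eulerDefect_mul_self {a : A⟦X⟧} (ha : Commute a a.euler) (n : ℕ) :
    a.eulerDefect n * a = n • (a ^ n * a.eulerDefect 1) := by
  have hc : a.eulerDefect 1 * a = a * a.eulerDefect 1 := by
    simp only [eulerDefect, pow_one, one_smul, sub_mul, mul_sub, ha.eq]
  induction n with
  | zero => simp [eulerDefect_zero]
  | succ n ih =>
    rw [eulerDefect_succ, ih, add_mul, smul_mul_assoc, mul_assoc, hc, ← mul_assoc, ← pow_succ,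
      add_smul, one_smul]

lemma PowerSeries.mul_pow_eq_of_commutator_eulerDefect {a h : A⟦X⟧}
    (hh : h * a = a * h - 2 • a.eulerDefect 1) (n : ℕ) :
    h * a ^ n = a ^ n * h - 2 • a.eulerDefect n := by
  induction n with
  | zero => simp [eulerDefect_zero]
  | succ n ih =>
    rw [pow_succ, ← mul_assoc, ih, sub_mul, mul_assoc, hh, eulerDefect_succ a n, mul_sub]
    simp only [smul_add, smul_mul_assoc, mul_smul_comm, mul_assoc]
    abel

lemma PowerSeries.mul_pow_succ_eq_of_commutator {a h e : A⟦X⟧} (ha : Commute a a.euler)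
    (hh : h * a = a * h - 2 • a.eulerDefect 1) (he : e * a = a * e + h) (n : ℕ) :
    e * a ^ (n + 1) =
      a ^ (n + 1) * e + (n + 1) • (a ^ n * h) - (n + 1) • a.eulerDefect n := by
  induction n with
  | zero => simp [eulerDefect_zero, he]
  | succ n ih =>
    rw [pow_succ _ (n + 1), ← mul_assoc, ih, eulerDefect_succ a n, sub_mul, add_mul,
      mul_assoc, he, smul_mul_assoc, smul_mul_assoc, mul_assoc (a ^ n), hh,
      eulerDefect_mul_self ha]
    simp only [mul_add, mul_sub, mul_smul_comm, ← mul_assoc, ← pow_succ]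
    module

lemma PowerSeries.coeff_mul_mem_of_right {J : Ideal A} (a : A⟦X⟧) {b : A⟦X⟧}
    (hb : ∀ n, coeff n b ∈ J) (n : ℕ) : coeff n (a * b) ∈ J := by
  rw [coeff_mul]
  exact sum_mem fun p _ => J.mul_mem_left _ (hb _)

lemma PowerSeries.coeff_pow_eq_sum_antidiagonalTuple (a : A⟦X⟧) (n j : ℕ) :
    coeff j (a ^ n) = ∑ r ∈ Finset.Nat.antidiagonalTuple n j,
      (List.ofFn fun i => coeff (r i) a).prod := by
  induction n generalizing j with
  | zero => rcases j with _ | j <;> simp [coeff_one]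
  | succ n ih =>
    rw [pow_succ', coeff_mul]
    simp only [ih, mul_sum]
    rw [sum_sigma']
    refine sum_bij' (fun x _ => Fin.cons x.1.1 x.2)
      (fun r _ => ⟨(r 0, ∑ i, Fin.tail r i), Fin.tail r⟩) ?_ ?_ ?_ ?_ ?_
    · rintro ⟨p, r⟩ h
      simp only [mem_sigma, HasAntidiagonal.mem_antidiagonal, Finset.Nat.mem_antidiagonalTuple] at h ⊢
      simp [Fin.sum_univ_succ, h.1, h.2]
    · intro r h
      simp only [mem_sigma, HasAntidiagonal.mem_antidiagonal, Finset.Nat.mem_antidiagonalTuple] at h ⊢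
      simp [← h, Fin.sum_univ_succ, Fin.tail]
    · rintro ⟨⟨p, q⟩, r⟩ h
      simp only [mem_sigma, HasAntidiagonal.mem_antidiagonal, Finset.Nat.mem_antidiagonalTuple] at h
      obtain ⟨-, rfl⟩ := h
      simp
    · intro r h
      simp
    · rintro ⟨p, r⟩ h
      simp [List.ofFn_succ]

end PowerSeries

section LoopRelations

open PowerSeries Finset

variable {A : Type*} [Ring A]

/-- The current `∑_{r ≥ 1} x_{s+r} uʳ`. -/
noncomputable def current (x : ℤ → A) (s : ℤ) : A⟦X⟧ := mk fun r => if r = 0 then 0 else x (s + r)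

lemma coeff_current (x : ℤ → A) (s : ℤ) (r : ℕ) :
    coeff r (current x s) = if r = 0 then 0 else x (s + r) := by
  simp [current]

lemma current_eq_mul_X (x : ℤ → A) (s : ℤ) :
    current x s = (mk fun r : ℕ => x (s + (r + 1 : ℕ))) * X := by
  ext r
  rcases r with _ | r <;> simp [coeff_current, coeff_succ_mul_X]

lemma current_pow_eq_mul_X_pow (x : ℤ → A) (s : ℤ) (n : ℕ) :
    current x s ^ n = (mk fun r : ℕ => x (s + (r + 1 : ℕ))) ^ n * X ^ n := by
  rw [current_eq_mul_X, (commute_X _).mul_pow]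

lemma coeff_current_pow_of_lt (x : ℤ → A) (s : ℤ) {j n : ℕ} (h : j < n) :
    coeff j (current x s ^ n) = 0 := by
  rw [current_pow_eq_mul_X_pow, coeff_mul_X_pow', if_neg (by omega)]

lemma coeff_current_pow_mul_self (x : ℤ → A) (s : ℤ) (n : ℕ) (L : A⟦X⟧) :
    coeff n (current x s ^ n * L) = x (s + 1) ^ n * coeff 0 L := by
  rw [current_pow_eq_mul_X_pow, mul_assoc, (commute_X_pow L n).symm.eq, ← mul_assoc,
    coeff_mul_X_pow', if_pos le_rfl, Nat.sub_self]
  simp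

lemma coeff_current_pow (x : ℤ → A) (s : ℤ) (n j : ℕ) :
    coeff j (current x s ^ n) =
      ∑ r ∈ (Finset.Nat.antidiagonalTuple n j).filter (fun r => ∀ i, 1 ≤ r i),
        (List.ofFn fun i : Fin n => x (s + (r i : ℤ))).prod := by
  rw [coeff_pow_eq_sum_antidiagonalTuple, sum_filter]
  refine sum_congr rfl fun r _ => ?_
  split_ifs with h
  · congr 2
    funext i
    rw [coeff_current, if_neg (by have := h i; omega)]
  · push Not at h
    obtain ⟨i, hi⟩ := h
    refine List.prod_eq_zero ((List.mem_ofFn' _ _).mpr ⟨i, ?_⟩)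
    simp [coeff_current, show r i = 0 by omega]

lemma commute_current_euler {F : ℤ → A} (hFF : ∀ i j, Commute (F i) (F j)) (s : ℤ) :
    Commute (current F s) (current F s).euler := by
  ext n
  rw [coeff_mul, coeff_mul, ← Finset.Nat.sum_antidiagonal_swap]
  refine sum_congr rfl fun p _ => ?_
  simp only [coeff_euler, coeff_current, Prod.fst_swap, Prod.snd_swap, mul_smul_comm,
    smul_mul_assoc]
  split_ifs <;> simp [(hFF _ _).eq]

lemma current_mul_current {F H : ℤ → A} (hHF : ∀ i j, H i * F j = F j * H i - 2 • F (i + j))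
    (s : ℤ) :
    current H 0 * current F s =
      current F s * current H 0 - 2 • (current F s).eulerDefect 1 := by
  ext n
  have key : ∀ p ∈ HasAntidiagonal.antidiagonal n, coeff p.1 (current H 0) * coeff p.2 (current F s) =
      coeff p.2 (current F s) * coeff p.1 (current H 0) -
        2 • (if p.1 = 0 ∨ p.2 = 0 then 0 else F (s + n)) := by
    intro p hp
    rw [coeff_current, coeff_current]
    by_cases h1 : p.1 = 0
    · simp [h1]
    by_cases h2 : p.2 = 0
    · simp [h2]
    have : (0 + (p.1 : ℤ)) + (s + p.2) = s + n := by
      rw [← HasAntidiagonal.mem_antidiagonal.mp hp]; push_cast; ring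
    simp [h1, h2, hHF, ← this]
  rw [coeff_mul, sum_congr rfl key, sum_sub_distrib, map_sub, ← smul_sum, map_nsmul]
  congr 1
  · rw [coeff_mul, ← Finset.Nat.sum_antidiagonal_swap]; rfl
  · congr 1
    simp only [eulerDefect, pow_one, one_smul, map_sub, coeff_euler, coeff_current]
    rw [Finset.Nat.sum_antidiagonal_eq_sum_range_succ_mk]
    rcases n with _ | n
    · simp
    rw [sum_range_succ, sum_range_succ', sum_congr rfl (g := fun _ => F (s + (n + 1 : ℕ)))]
    · simp [add_smul]
    · intro i hi
      have := mem_range.mp hi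
      rw [if_neg (by omega)]

lemma C_mul_current {E F H : ℤ → A} (hEF : ∀ i j, E i * F j = F j * E i + H (i + j)) (s : ℤ) :
    PowerSeries.C (E (-s)) * current F s = current F s * PowerSeries.C (E (-s)) + current H 0 := by
  ext n
  simp only [map_add, coeff_C_mul, coeff_mul_C, coeff_current]
  split_ifs
  · simp
  · rw [hEF]; congr 2; ring

lemma mul_mem_of_recursion [Algebra ℚ A] {E H : ℤ → A}
    (hEH : ∀ i j, E i * H j = H j * E i - 2 • E (i + j)) {J : Ideal A} (hJ : ∀ r, E r ∈ J)
    {Λ : ℕ → A} (hΛ0 : Λ 0 = 1)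
    (hΛ : ∀ m : ℕ, 1 ≤ m → (m : ℚ) • Λ m = -∑ q ∈ Icc 1 m, H (q : ℤ) * Λ (m - q))
    (m : ℕ) (r : ℤ) : E r * Λ m ∈ J := by
  induction m using Nat.strong_induction_on generalizing r with
  | _ m ih =>
    rcases Nat.eq_zero_or_pos m with rfl | hm
    · simpa [hΛ0] using hJ r
    have hmem : (m : ℚ) • (E r * Λ m) ∈ J := by
      rw [← mul_smul_comm, hΛ m hm, mul_neg, mul_sum]
      refine neg_mem (sum_mem fun q hq => ?_)
      have hq := mem_Icc.mp hq
      rw [← mul_assoc, hEH, sub_mul, mul_assoc, smul_mul_assoc]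
      exact sub_mem (J.mul_mem_left _ (ih _ (by omega) _)) (nsmul_mem (ih _ (by omega) _) 2)
    have := Submodule.smul_of_tower_mem J ((m : ℚ)⁻¹) hmem
    rwa [smul_smul, inv_mul_cancel₀ (by positivity), one_smul] at this

lemma euler_mk_of_recursion [Algebra ℚ A] {H : ℤ → A} {Λ : ℕ → A}
    (hΛ : ∀ m : ℕ, 1 ≤ m → (m : ℚ) • Λ m = -∑ q ∈ Icc 1 m, H (q : ℤ) * Λ (m - q)) :
    (mk Λ).euler = -(current H 0 * mk Λ) := by
  ext n
  rcases n with _ | n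
  · simp only [coeff_euler, zero_smul, map_neg, coeff_mul, HasAntidiagonal.antidiagonal_zero]
    simp [current]
  have h := hΛ (n + 1) (by omega)
  rw [coeff_euler, coeff_mk, map_neg, coeff_mul, ← Nat.cast_smul_eq_nsmul ℚ, h,
    Finset.Nat.sum_antidiagonal_eq_sum_range_succ_mk, sum_range_succ', range_eq_Ico,
    sum_Ico_add' (fun i => coeff i (current H 0) * coeff (n + 1 - i) (mk Λ)) 0 (n + 1) 1]
  simp only [coeff_current, coeff_mk, if_true, zero_mul, add_zero, zero_add]
  congr 1
  refine sum_congr rfl fun q hq => ?_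
  rw [if_neg (by have := mem_Icc.mp hq; omega)]

/-- Multiplying by `e_{-s}` lowers the exponent of the current of the `f_r` by one. -/
lemma mul_coeff_current_pow_succ_mem [Algebra ℚ A] {E F H : ℤ → A}
    (hFF : ∀ i j, Commute (F i) (F j))
    (hHF : ∀ i j, H i * F j = F j * H i - 2 • F (i + j))
    (hEF : ∀ i j, E i * F j = F j * E i + H (i + j))
    (hEH : ∀ i j, E i * H j = H j * E i - 2 • E (i + j)) {J : Ideal A} (hJ : ∀ r, E r ∈ J)
    {Λ : ℕ → A} (hΛ0 : Λ 0 = 1)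
    (hΛ : ∀ m : ℕ, 1 ≤ m → (m : ℚ) • Λ m = -∑ q ∈ Icc 1 m, H (q : ℤ) * Λ (m - q))
    (s : ℤ) (n d : ℕ) :
    E (-s) * coeff (n + d) (current F s ^ (n + 1) * mk Λ) +
      ((n + 1) * d) • coeff (n + d) (current F s ^ n * mk Λ) ∈ J := by
  have hE : ∀ m, coeff m (PowerSeries.C (E (-s)) * mk Λ) ∈ J := fun m => by
    rw [coeff_C_mul, coeff_mk]
    exact mul_mem_of_recursion hEH hJ hΛ0 hΛ m _
  convert coeff_mul_mem_of_right (current F s ^ (n + 1)) hE (n + d) using 1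
  have hcomm := mul_pow_succ_eq_of_commutator (commute_current_euler hFF s)
    (current_mul_current hHF s) (C_mul_current hEF s) n
  have heuler := euler_mul (current F s ^ n) (mk Λ)
  rw [euler_mk_of_recursion hΛ] at heuler
  have hseries : PowerSeries.C (E (-s)) * (current F s ^ (n + 1) * mk Λ) =
      current F s ^ (n + 1) * (PowerSeries.C (E (-s)) * mk Λ) -
        (n + 1) • ((current F s ^ n * mk Λ).euler - n • (current F s ^ n * mk Λ)) := by
    rw [← mul_assoc, hcomm, heuler, eulerDefect]
    simp only [sub_mul, add_mul, smul_mul_assoc, mul_neg, mul_assoc]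
    module
  have := congrArg (coeff (n + d)) hseries
  rw [coeff_C_mul] at this
  rw [this]
  simp only [map_sub, map_nsmul, coeff_euler]
  module

lemma pow_mul_pow_sub_coeff_mem [Algebra ℚ A] {E F H : ℤ → A}
    (hFF : ∀ i j, Commute (F i) (F j))
    (hHF : ∀ i j, H i * F j = F j * H i - 2 • F (i + j))
    (hEF : ∀ i j, E i * F j = F j * E i + H (i + j))
    (hEH : ∀ i j, E i * H j = H j * E i - 2 • E (i + j)) {J : Ideal A} (hJ : ∀ r, E r ∈ J)
    {Λ : ℕ → A} (hΛ0 : Λ 0 = 1)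
    (hΛ : ∀ m : ℕ, 1 ≤ m → (m : ℚ) • Λ m = -∑ q ∈ Icc 1 m, H (q : ℤ) * Λ (m - q))
    (s : ℤ) (n l : ℕ) :
    ((l.factorial : ℚ)⁻¹ * ((n + l).factorial : ℚ)⁻¹) • (E (-s) ^ l * F (s + 1) ^ (n + l)) -
      ((-1 : ℚ) ^ l * (n.factorial : ℚ)⁻¹) • coeff (n + l) (current F s ^ n * mk Λ) ∈ J := by
  induction l generalizing n with
  | zero => simp [coeff_current_pow_mul_self, hΛ0]
  | succ l ih =>
    have h1 := Submodule.smul_of_tower_mem J ((l + 1 : ℚ)⁻¹)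
      (J.mul_mem_left (E (-s)) (ih (n + 1)))
    have h2 := Submodule.smul_of_tower_mem J
      ((l + 1 : ℚ)⁻¹ * ((-1 : ℚ) ^ l * ((n + 1).factorial : ℚ)⁻¹))
      (mul_coeff_current_pow_succ_mem hFF hHF hEF hEH hJ hΛ0 hΛ s n (l + 1))
    convert add_mem h1 h2 using 1
    rw [show n + 1 + l = n + (l + 1) by ring, mul_sub, pow_succ' (E (-s)), mul_smul_comm,
      mul_smul_comm, smul_sub, smul_add, ← mul_assoc, ← Nat.cast_smul_eq_nsmul ℚ]
    simp only [smul_smul]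
    rw [Nat.factorial_succ l, Nat.factorial_succ n]
    push_cast
    match_scalars <;> field_simp <;> ring

end LoopRelations

section LoopSl2

attribute [local instance] LieRing.ofAssociativeRing

lemma lie_tmul_T (x y : sl (Fin 2) ℚ) (i j : ℤ) :
    ⁅(T i : ℚ[T;T⁻¹]) ⊗ₜ[ℚ] x, (T j : ℚ[T;T⁻¹]) ⊗ₜ[ℚ] y⁆ =
      (T (i + j) : ℚ[T;T⁻¹]) ⊗ₜ[ℚ] ⁅x, y⁆ := by
  rw [LieAlgebra.ExtendScalars.bracket_tmul, T_add]

lemma ι_tmul_mul_ι_tmul (x y : sl (Fin 2) ℚ) (i j : ℤ) :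
    (UniversalEnvelopingAlgebra.ι ℚ ((T i : ℚ[T;T⁻¹]) ⊗ₜ[ℚ] x) : Ug) *
        UniversalEnvelopingAlgebra.ι ℚ ((T j : ℚ[T;T⁻¹]) ⊗ₜ[ℚ] y) =
      UniversalEnvelopingAlgebra.ι ℚ ((T j : ℚ[T;T⁻¹]) ⊗ₜ[ℚ] y) *
        UniversalEnvelopingAlgebra.ι ℚ ((T i : ℚ[T;T⁻¹]) ⊗ₜ[ℚ] x) +
      UniversalEnvelopingAlgebra.ι ℚ ((T (i + j) : ℚ[T;T⁻¹]) ⊗ₜ[ℚ] ⁅x, y⁆) := by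
  rw [← lie_tmul_T, LieHom.map_lie, LieRing.of_associative_ring_bracket]
  abel

lemma lie_Esl2_Fsl2 : ⁅Esl2, Fsl2⁆ = Hsl2 := by
  apply Subtype.ext
  simp [Esl2, Fsl2, Hsl2, LieSubalgebra.coe_bracket, Ring.lie_def]

lemma lie_Hsl2_Fsl2 : ⁅Hsl2, Fsl2⁆ = -(2 • Fsl2) := by
  apply Subtype.ext
  ext i j
  fin_cases i <;> fin_cases j <;>
    norm_num [Fsl2, Hsl2, LieSubalgebra.coe_bracket, Ring.lie_def]

lemma lie_Esl2_Hsl2 : ⁅Esl2, Hsl2⁆ = -(2 • Esl2) := by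
  apply Subtype.ext
  simp [Esl2, Hsl2, LieSubalgebra.coe_bracket, Ring.lie_def]
  norm_num

lemma Fel_commute (i j : ℤ) : Commute (Fel i) (Fel j) := by
  have := ι_tmul_mul_ι_tmul Fsl2 Fsl2 i j
  rwa [lie_self, TensorProduct.tmul_zero, map_zero, add_zero] at this

lemma Eel_mul_Fel (i j : ℤ) : Eel i * Fel j = Fel j * Eel i + Hel (i + j) := by
  have := ι_tmul_mul_ι_tmul Esl2 Fsl2 i j
  rwa [lie_Esl2_Fsl2] at this

lemma Hel_mul_Fel (i j : ℤ) : Hel i * Fel j = Fel j * Hel i - 2 • Fel (i + j) := by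
  have := ι_tmul_mul_ι_tmul Hsl2 Fsl2 i j
  rwa [lie_Hsl2_Fsl2, TensorProduct.tmul_neg, TensorProduct.tmul_smul, map_neg, map_nsmul,
    ← sub_eq_add_neg] at this

lemma Eel_mul_Hel (i j : ℤ) : Eel i * Hel j = Hel j * Eel i - 2 • Eel (i + j) := by
  have := ι_tmul_mul_ι_tmul Esl2 Hsl2 i j
  rwa [lie_Esl2_Hsl2, TensorProduct.tmul_neg, TensorProduct.tmul_smul, map_neg, map_nsmul,
    ← sub_eq_add_neg] at this

end LoopSl2

/-- Garland's identity: modulo the left ideal generated by the `e_r`,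
`e_{−s}^{(l)} f_{s+1}^{(k)} ≡ (−1)ˡ (X⁻(u)^{(k−l)} Λ(u))_k`, where
`Λ_m` is given by `Λ_0 = 1`, `m Λ_m = −∑_{q=1}^m h_q Λ_{m−q}`, and
`(X⁻(u)^{(k−l)} Λ(u))_k = ∑_{j=k−l}^k c_j Λ_{k−j}` with
`c_j = (1/(k−l)!) ∑_{r_1+⋯+r_{k−l}=j, r_i ≥ 1} f_{s+r_1}⋯f_{s+r_{k−l}}`. -/
theorem garland_identity (Λ : ℕ → Ug) (hΛ0 : Λ 0 = 1)
    (hΛ : ∀ m : ℕ, 1 ≤ m → (m : ℚ) • Λ m =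
      -∑ q ∈ Finset.Icc 1 m, Hel (q : ℤ) * Λ (m - q))
    (k l : ℕ) (hl : 1 ≤ l) (hlk : l ≤ k) (s : ℤ) :
    ∀ c : ℕ → Ug,
      (∀ j : ℕ, c j = ((k - l).factorial : ℚ)⁻¹ •
        ∑ r ∈ (Finset.Nat.antidiagonalTuple (k - l) j).filter (fun r => ∀ i, 1 ≤ r i),
          (List.ofFn fun i : Fin (k - l) => Fel (s + (r i : ℤ))).prod) →
      ∀ G : Ug, G = ∑ j ∈ Finset.Icc (k - l) k, c j * Λ (k - j) →
        ((l.factorial : ℚ)⁻¹ * (k.factorial : ℚ)⁻¹) • (Eel (-s) ^ l * Fel (s + 1) ^ k)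
            - (-1 : ℚ) ^ l • G
          ∈ Ideal.span {x : Ug | ∃ r : ℤ, x = Eel r} := by
  intro c hc G hG
  obtain ⟨n, rfl⟩ := Nat.exists_eq_add_of_le' hlk
  rw [Nat.add_sub_cancel] at hc hG
  have hGcoeff : G = (n.factorial : ℚ)⁻¹ •
      PowerSeries.coeff (n + l) (current Fel s ^ n * PowerSeries.mk Λ) := by
    rw [hG, PowerSeries.coeff_mul, Finset.Nat.sum_antidiagonal_eq_sum_range_succ_mk,
      Finset.smul_sum]
    refine Finset.sum_subset_zero_on_sdiff (fun j hj => ?_) (fun j hj => ?_) (fun j _ => ?_)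
    · have := Finset.mem_Icc.mp hj
      exact Finset.mem_range.mpr (by omega)
    · simp only [Finset.mem_sdiff, Finset.mem_range, Finset.mem_Icc] at hj
      rw [coeff_current_pow_of_lt _ _ (by omega), zero_mul, smul_zero]
    · rw [hc, coeff_current_pow, PowerSeries.coeff_mk, smul_mul_assoc]
  rw [hGcoeff, smul_smul]
  exact pow_mul_pow_sub_coeff_mem Fel_commute Hel_mul_Fel Eel_mul_Fel Eel_mul_Hel
    (fun r => Ideal.subset_span (Set.mem_ofPred.mpr ⟨r, rfl⟩)) hΛ0 hΛ s n l
end
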